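/- arXiv:1303.3718 — 2 statements merged into one kernel-verified Lean document; each statement's English description precedes it below -/
import Mathlib

section
/- Let C be a pointed category with basepoint pt such that C is nonempty and any two objects of C are isomorphic (equivalently, C is equivalent to a category with one object). Then the reduced universal monoid U[C] is isomorphic, as a monoid, to the free group on the set of objects of C other than pt. -/
open CategoryTheory

/-- The set of all morphisms of a small category `C`. -/
abbrev Mor (C : Type) [SmallCategory C] : Type := Σ x y : C, x ⟶ y

/-- The generating relations for the universal monoid `U(C)` on a small category `C`:
the identity `id_x` of each object is related to `1`, and the composite `g ∘ f` of a
composable pair `f : x → y`, `g : y → z` is related to the product `f·g`. -/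
def uRel (C : Type) [SmallCategory C] :
    FreeMonoid (Mor C) → FreeMonoid (Mor C) → Prop := fun a b =>
  (∃ x : C, a = FreeMonoid.of ⟨x, x, 𝟙 x⟩ ∧ b = 1) ∨
  (∃ (x y z : C) (f : x ⟶ y) (g : y ⟶ z),
    a = FreeMonoid.of ⟨x, z, f ≫ g⟩ ∧
    b = FreeMonoid.of ⟨x, y, f⟩ * FreeMonoid.of ⟨y, z, g⟩)

/-- The universal monoid `U(C)` of a small category `C`: the quotient of the free
monoid on the set of all morphisms of `C` by the monoid congruence generated by the
relations `id_x ~ 1` and `(g ∘ f) ~ f·g`. -/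
abbrev UMon (C : Type) [SmallCategory C] : Type := (conGen (uRel C)).Quotient

/-- The class `⟦f⟧` in `U(C)` of a morphism `f` of `C`. -/
def UMon.mk {C : Type} [SmallCategory C] {x y : C} (f : x ⟶ y) : UMon C :=
  (conGen (uRel C)).mk' (FreeMonoid.of ⟨x, y, f⟩)

/-- The generating relations for the reduced universal monoid `U[C]` of a pointed
category `(C, pt)`: in addition to the relations of `U(C)`, every endomorphism of the
basepoint `pt` is related to `1`. -/
def uRedRel (C : Type) [SmallCategory C] (pt : C) :
    FreeMonoid (Mor C) → FreeMonoid (Mor C) → Prop := fun a b =>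
  uRel C a b ∨ (∃ e : pt ⟶ pt, a = FreeMonoid.of ⟨pt, pt, e⟩ ∧ b = 1)

/-- The reduced universal monoid `U[C]` of a pointed category `(C, pt)`: the quotient
of the free monoid on the morphisms of `C` by the monoid congruence generated by the
relations `id_x ~ 1`, `(g ∘ f) ~ f·g`, and `e ~ 1` for every endomorphism `e` of `pt`. -/
abbrev URed (C : Type) [SmallCategory C] (pt : C) : Type := (conGen (uRedRel C pt)).Quotient

/-- The class `⟦f⟧` in `U[C]` of a morphism `f` of `C`. -/
def URed.mk {C : Type} [SmallCategory C] (pt : C) {x y : C} (f : x ⟶ y) : URed C pt :=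
  (conGen (uRedRel C pt)).mk' (FreeMonoid.of ⟨x, y, f⟩)

section

variable {C : Type} {pt : C}

open Classical in
/-- The generator of the free group attached to an object, with the basepoint sent to `1`. -/
noncomputable def objGen (pt x : C) : FreeGroup {y : C // y ≠ pt} :=
  if h : x = pt then 1 else FreeGroup.of ⟨x, h⟩

theorem objGen_self (pt : C) : objGen pt pt = 1 := dif_pos rfl

theorem objGen_coe (y : {y : C // y ≠ pt}) : objGen pt y = FreeGroup.of y := dif_neg y.2

theorem lift_objGen {G : Type*} [Group G] (g : C → G) (hg : g pt = 1) (x : C) :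
    FreeGroup.lift (fun y : {y : C // y ≠ pt} => g y) (objGen pt x) = g x := by
  rcases eq_or_ne x pt with rfl | hx
  · rw [objGen_self, map_one, hg]
  · rw [objGen_coe ⟨x, hx⟩, FreeGroup.lift_apply_of]

variable [SmallCategory C]

namespace URed

theorem mk_id (pt x : C) : URed.mk pt (𝟙 x) = 1 :=
  (Con.eq _).2 (ConGen.Rel.of _ _ (Or.inl (Or.inl ⟨x, rfl, rfl⟩)))

theorem mk_comp (pt : C) {x y z : C} (f : x ⟶ y) (g : y ⟶ z) :
    URed.mk pt (f ≫ g) = URed.mk pt f * URed.mk pt g :=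
  (Con.eq _).2 (ConGen.Rel.of _ _ (Or.inl (Or.inr ⟨x, y, z, f, g, rfl, rfl⟩)))

theorem mk_end (e : pt ⟶ pt) : URed.mk pt e = 1 :=
  (Con.eq _).2 (ConGen.Rel.of _ _ (Or.inr ⟨e, rfl, rfl⟩))

/-- Homomorphisms out of `U[C]` are determined by their values on classes of morphisms. -/
theorem hom_ext {M : Type*} [Monoid M] {φ ψ : URed C pt →* M}
    (h : ∀ {x y : C} (f : x ⟶ y), φ (URed.mk pt f) = ψ (URed.mk pt f)) : φ = ψ :=
  Con.hom_ext (FreeMonoid.hom_eq fun ⟨_, _, f⟩ => h f)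

/-- An isomorphism of `C` has invertible class in `U[C]`. -/
def unitOfIso (pt : C) {x y : C} (i : x ≅ y) : (URed C pt)ˣ where
  val := URed.mk pt i.hom
  inv := URed.mk pt i.inv
  val_inv := by rw [← mk_comp, i.hom_inv_id, mk_id]
  inv_val := by rw [← mk_comp, i.inv_hom_id, mk_id]

theorem unitOfIso_end (i : pt ≅ pt) : unitOfIso pt i = 1 :=
  Units.ext (mk_end i.hom)

theorem mk_eq (i : ∀ x : C, pt ≅ x) {x y : C} (f : x ⟶ y) :
    URed.mk pt f = ↑((unitOfIso pt (i x))⁻¹ * unitOfIso pt (i y)) := by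
  rw [Units.val_mul, Units.eq_inv_mul_iff_mul_eq]
  calc URed.mk pt (i x).hom * URed.mk pt f
      = URed.mk pt (((i x).hom ≫ f ≫ (i y).inv) ≫ (i y).hom) := by simp [← mk_comp]
    _ = URed.mk pt (i y).hom := by rw [mk_comp, mk_end, one_mul]

/-- A group-valued function `g` on objects with `g pt = 1` induces the homomorphism on `U[C]`
sending the class of `f : x ⟶ y` to `(g x)⁻¹ * g y`. -/
def liftObj {G : Type*} [Group G] (g : C → G) (hg : g pt = 1) : URed C pt →* G :=
  Con.lift _ (FreeMonoid.lift fun f : Mor C => (g f.1)⁻¹ * g f.2.1) <| Con.conGen_le.2 <| by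
    rintro _ _ ((⟨x, rfl, rfl⟩ | ⟨x, y, z, f, f', rfl, rfl⟩) | ⟨e, rfl, rfl⟩) <;>
      simp [hg, mul_assoc]

theorem liftObj_mk {G : Type*} [Group G] (g : C → G) (hg : g pt = 1) {x y : C} (f : x ⟶ y) :
    liftObj g hg (URed.mk pt f) = (g x)⁻¹ * g y :=
  FreeMonoid.lift_eval_of _ _

end URed

end

/-- Let `(C, pt)` be a pointed category such that any two objects of `C` are isomorphic
(equivalently, `C` is nonempty and equivalent to a category with one object).  Then the
reduced universal monoid `U[C]` is isomorphic, as a monoid, to the free group on the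
set of objects of `C` other than `pt`. -/
theorem uRed_iso_freeGroup (C : Type) [SmallCategory C] (pt : C)
    (h : ∀ x y : C, Nonempty (x ≅ y)) :
    Nonempty (URed C pt ≃* FreeGroup {y : C // y ≠ pt}) := by
  let i : ∀ x : C, pt ≅ x := fun x => (h pt x).some
  let u : C → (URed C pt)ˣ := fun x => URed.unitOfIso pt (i x)
  have hu : u pt = 1 := URed.unitOfIso_end (i pt)
  refine ⟨MonoidHom.toMulEquiv (URed.liftObj (objGen pt) (objGen_self pt))
    ((Units.coeHom _).comp (FreeGroup.lift fun y : {y : C // y ≠ pt} => u y)) ?_ ?_⟩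
  · refine URed.hom_ext fun f => ?_
    rw [MonoidHom.comp_apply, MonoidHom.comp_apply, URed.liftObj_mk, map_mul, map_inv,
      lift_objGen u hu, lift_objGen u hu, Units.coeHom_apply, MonoidHom.id_apply, URed.mk_eq i f]
  · refine FreeGroup.ext_hom _ _ fun y => ?_
    simp only [MonoidHom.comp_apply, MonoidHom.id_apply, FreeGroup.lift_apply_of,
      Units.coeHom_apply]
    change URed.liftObj _ _ (URed.mk pt (i y).hom) = _
    rw [URed.liftObj_mk, objGen_self, inv_one, one_mul, objGen_coe]
end

section
/- Let M be a monoid with a right action on a pointed set X that fixes the basepoint pt. Define J^M[X] to be the quotient of the free monoid on the set of pairs X × M by the monoid congruence generated by: (pt, m) ~ 1 for all m ∈ M; (x, 1) ~ 1 for all x ∈ X; and (x, m)·(x·m, k) ~ (x, m·k) for all x ∈ X and m, k ∈ M. Then J^M[X] is isomorphic, as a monoid, to the reduced universal monoid U[X//M] of the pointed action category X//M, via the map sending the class of (x, m) to the class of the morphism m : x → x·m. -/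
open CategoryTheory

/-- A right action of a monoid `M` on a type `X`. -/
class RightAction (M X : Type) [Monoid M] where
  act : X → M → X
  act_one : ∀ x : X, act x 1 = x
  act_mul : ∀ (x : X) (m k : M), act (act x m) k = act x (m * k)

/-- The action category `X // M` of a right action of a monoid `M` on `X`:
objects are the elements of `X`, and a morphism `x ⟶ y` is an element `m : M`
with `y = x · m`. -/
structure ActionCat (M X : Type) [Monoid M] [RightAction M X] where
  obj : X

instance (M X : Type) [Monoid M] [RightAction M X] : Category (ActionCat M X) where
  Hom a b := { m : M // RightAction.act a.obj m = b.obj }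
  id a := ⟨1, RightAction.act_one a.obj⟩
  comp f g := ⟨f.1 * g.1, by rw [← RightAction.act_mul, f.2, g.2]⟩
  id_comp f := Subtype.ext (one_mul _)
  comp_id f := Subtype.ext (mul_one _)
  assoc f g h := Subtype.ext (mul_assoc _ _ _)



/-- The generating relations for the construction `J^M[X]` on a pointed right `M`-set
`(X, pt)`: `(pt, m) ~ 1` for all `m`, `(x, 1) ~ 1` for all `x`, and
`(x, m)·(x·m, k) ~ (x, m·k)` for all `x`, `m`, `k`. -/
def jRel (M X : Type) [Monoid M] [RightAction M X] (pt : X) :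
    FreeMonoid (X × M) → FreeMonoid (X × M) → Prop := fun a b =>
  (∃ m : M, a = FreeMonoid.of (pt, m) ∧ b = 1) ∨
  (∃ x : X, a = FreeMonoid.of (x, (1 : M)) ∧ b = 1) ∨
  (∃ (x : X) (m k : M),
    a = FreeMonoid.of (x, m) * FreeMonoid.of (RightAction.act x m, k) ∧
    b = FreeMonoid.of (x, m * k))

/-- The monoid `J^M[X]` of a pointed right `M`-set `(X, pt)`: the quotient of the free
monoid on `X × M` by the monoid congruence generated by `jRel`. -/
abbrev JMon (M X : Type) [Monoid M] [RightAction M X] (pt : X) : Type :=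
  (conGen (jRel M X pt)).Quotient

/-- The class of a pair `(x, m)` in `J^M[X]`. -/
def JMon.mk {M X : Type} [Monoid M] [RightAction M X] (pt : X) (x : X) (m : M) :
    JMon M X pt :=
  (conGen (jRel M X pt)).mk' (FreeMonoid.of (x, m))

theorem URed.mk_id_s17 {C : Type} [SmallCategory C] (pt x : C) :
    URed.mk pt (𝟙 x) = 1 :=
  (Con.eq _).2 (ConGen.Rel.of _ _ (Or.inl (Or.inl ⟨x, rfl, rfl⟩)))

theorem URed.mk_comp_s17 {C : Type} [SmallCategory C] (pt : C) {x y z : C}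
    (f : x ⟶ y) (g : y ⟶ z) :
    URed.mk pt (f ≫ g) = URed.mk pt f * URed.mk pt g :=
  (Con.eq _).2 (ConGen.Rel.of _ _ (Or.inl (Or.inr ⟨x, y, z, f, g, rfl, rfl⟩)))

theorem URed.mk_endo {C : Type} [SmallCategory C] (pt : C) (e : pt ⟶ pt) :
    URed.mk pt e = 1 :=
  (Con.eq _).2 (ConGen.Rel.of _ _ (Or.inr ⟨e, rfl, rfl⟩))

theorem JMon.mk_pt {M X : Type} [Monoid M] [RightAction M X] (pt : X) (m : M) :
    JMon.mk pt pt m = 1 :=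
  (Con.eq _).2 (ConGen.Rel.of _ _ (Or.inl ⟨m, rfl, rfl⟩))

theorem JMon.mk_one {M X : Type} [Monoid M] [RightAction M X] (pt x : X) :
    JMon.mk pt x (1 : M) = 1 :=
  (Con.eq _).2 (ConGen.Rel.of _ _ (Or.inr (Or.inl ⟨x, rfl, rfl⟩)))

theorem JMon.mk_mul {M X : Type} [Monoid M] [RightAction M X] (pt x : X) (m k : M) :
    JMon.mk pt x m * JMon.mk pt (RightAction.act x m) k = JMon.mk pt x (m * k) :=
  (Con.eq _).2 (ConGen.Rel.of _ _ (Or.inr (Or.inr ⟨x, m, k, rfl, rfl⟩)))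

/-- The morphism `m : x ⟶ x·m` of the action category. -/
def ActionCat.homOfAct {M X : Type} [Monoid M] [RightAction M X] (x : X) (m : M) :
    (⟨x⟩ : ActionCat M X) ⟶ ⟨RightAction.act x m⟩ :=
  ⟨m, rfl⟩

/-- The class in `U[X // M]` of a morphism depends only on its source and on the
underlying element of `M`. -/
theorem URed.mk_congr_target {M X : Type} [Monoid M] [RightAction M X]
    (pt : ActionCat M X) {x y z : ActionCat M X} (f : x ⟶ y) (g : x ⟶ z)
    (h : f.1 = g.1) : URed.mk pt f = URed.mk pt g := by
  obtain rfl : y = z := congrArg ActionCat.mk (f.2.symm.trans (h ▸ g.2))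
  obtain rfl : f = g := Subtype.ext h
  rfl

/-- The homomorphism `J^M[X] → U[X // M]` sending the class of `(x, m)` to the class
of the morphism `m : x ⟶ x·m`. -/
def JMon.toURed {M X : Type} [Monoid M] [RightAction M X] (pt : X)
    (hpt : ∀ m : M, RightAction.act pt m = pt) :
    JMon M X pt →* URed (ActionCat M X) ⟨pt⟩ :=
  (conGen (jRel M X pt)).lift
    (FreeMonoid.lift fun p => URed.mk ⟨pt⟩ (ActionCat.homOfAct p.1 p.2)) <| by
      refine Con.conGen_le.2 ?_
      rintro a b (⟨m, rfl, rfl⟩ | ⟨x, rfl, rfl⟩ | ⟨x, m, k, rfl, rfl⟩)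
      · simp only [Con.ker_rel, FreeMonoid.lift_eval_of, map_one]
        exact (URed.mk_congr_target _ (ActionCat.homOfAct pt m)
          (show (⟨pt⟩ : ActionCat M X) ⟶ ⟨pt⟩ from ⟨m, hpt m⟩) rfl).trans (URed.mk_endo _ _)
      · simp only [Con.ker_rel, FreeMonoid.lift_eval_of, map_one]
        exact (URed.mk_congr_target _ (ActionCat.homOfAct x 1) (𝟙 _) rfl).trans
          (URed.mk_id_s17 _ _)
      · simp only [Con.ker_rel, FreeMonoid.lift_eval_of, map_mul]
        exact (URed.mk_comp_s17 _ _ _).symm.trans (URed.mk_congr_target _ _ _ rfl)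

/-- The homomorphism `U[X // M] → J^M[X]` sending the class of a morphism `m : x ⟶ y`
to the class of `(x, m)`. -/
def URed.toJMon {M X : Type} [Monoid M] [RightAction M X] (pt : X) :
    URed (ActionCat M X) ⟨pt⟩ →* JMon M X pt :=
  (conGen (uRedRel (ActionCat M X) ⟨pt⟩)).lift
    (FreeMonoid.lift fun f => JMon.mk pt f.1.obj f.2.2.1) <| by
      refine Con.conGen_le.2 ?_
      rintro a b ((⟨x, rfl, rfl⟩ | ⟨x, y, z, f, g, rfl, rfl⟩) | ⟨e, rfl, rfl⟩)
      · simp only [Con.ker_rel, FreeMonoid.lift_eval_of, map_one]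
        exact JMon.mk_one _ _
      · simp only [Con.ker_rel, FreeMonoid.lift_eval_of, map_mul]
        exact (JMon.mk_mul _ _ f.1 g.1).symm.trans (by rw [f.2])
      · simp only [Con.ker_rel, FreeMonoid.lift_eval_of, map_one]
        exact JMon.mk_pt _ _

theorem URed.toJMon_comp_toURed {M X : Type} [Monoid M] [RightAction M X] (pt : X)
    (hpt : ∀ m : M, RightAction.act pt m = pt) :
    (URed.toJMon pt).comp (JMon.toURed pt hpt) = MonoidHom.id (JMon M X pt) :=
  Con.hom_ext (FreeMonoid.hom_eq fun _ => rfl)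

theorem JMon.toURed_comp_toJMon {M X : Type} [Monoid M] [RightAction M X] (pt : X)
    (hpt : ∀ m : M, RightAction.act pt m = pt) :
    (JMon.toURed pt hpt).comp (URed.toJMon pt) =
      MonoidHom.id (URed (ActionCat M X) ⟨pt⟩) :=
  Con.hom_ext (FreeMonoid.hom_eq fun f =>
    URed.mk_congr_target _ (ActionCat.homOfAct f.1.obj f.2.2.1) f.2.2 rfl)

/-- `J^M[X]` is isomorphic, as a monoid, to the reduced universal monoid `U[X // M]`
of the pointed action category `X // M`, via the map sending the class of `(x, m)` to
the class of the morphism `m : x ⟶ x·m`. -/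
theorem jMon_iso_uRed_actionCat (M X : Type) [Monoid M] [RightAction M X]
    (pt : X) (hpt : ∀ m : M, RightAction.act pt m = pt) :
    ∃ e : JMon M X pt ≃* URed (ActionCat M X) ⟨pt⟩,
      ∀ (x : X) (m : M),
        e (JMon.mk pt x m) =
          URed.mk ⟨pt⟩
            (show (⟨x⟩ : ActionCat M X) ⟶ ⟨RightAction.act x m⟩ from ⟨m, rfl⟩) := by
  exact ⟨MonoidHom.toMulEquiv (JMon.toURed pt hpt) (URed.toJMon pt)
    (URed.toJMon_comp_toURed pt hpt) (JMon.toURed_comp_toJMon pt hpt),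
    fun _ _ => rfl⟩
end
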